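/- arXiv:1612.03408 — 2 statements merged into one kernel-verified Lean document; each statement's English description precedes it below -/
import Mathlib

section
/- Let A and B be commutative rings, f : A → B a ring homomorphism, and J an ideal of B with J ⊆ Nil(B). Then A⋈^f J is Cohen-Macaulay in the sense of ideals if and only if A is Cohen-Macaulay in the sense of ideals and kgr_A(𝔞, J) ≥ height 𝔞 for every ideal 𝔞 of A. -/
/-- The Koszul cochain differential of the complex `Hom(K_•(x), M)`, described explicitly:
the degree-`i` term is the module of `M`-valued functions on the `i`-element subsets of
`Fin n`, and the differential is the usual alternating-sum formula. -/
noncomputable def koszulMap (A : Type*) [CommRing A] (M : Type*) [AddCommGroup M]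
    [Module A M] {n : ℕ} (x : Fin n → A) (i : ℕ) :
    ({s : Finset (Fin n) // s.card = i} → M) →ₗ[A]
      ({s : Finset (Fin n) // s.card = i + 1} → M) where
  toFun g t := ∑ j ∈ t.1.attach,
    (((-1 : A) ^ ((t.1.filter (fun k => k < j.1)).card)) * x j.1) •
      g ⟨t.1.erase j.1, by
        rw [Finset.card_erase_of_mem j.2, t.2]; omega⟩

  map_add' g h := funext fun t => by
    simp [smul_add, Finset.sum_add_distrib]
  map_smul' a g := funext fun t => by
    simp only [Pi.smul_apply, RingHom.id_apply, Finset.smul_sum]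
    exact Finset.sum_congr rfl fun j _ => by
      rw [smul_smul, smul_smul, mul_comm]

/-- Nonvanishing of the `i`-th cohomology `H^i(Hom(K_•(x), M))` of the Koszul
cochain complex. -/
def koszulCohomologyNeZero (A : Type*) [CommRing A] (M : Type*) [AddCommGroup M]
    [Module A M] {n : ℕ} (x : Fin n → A) : ℕ → Prop
  | 0 => LinearMap.ker (koszulMap A M x 0) ≠ ⊥
  | (i + 1) => ¬ (LinearMap.ker (koszulMap A M x (i + 1)) ≤
      LinearMap.range (koszulMap A M x i))

/-- The Koszul grade of a finite sequence `x` on `M`: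
`inf { i : H^i(Hom(K_•(x), M)) ≠ 0 }` (an element of `ℕ∞`, equal to `⊤` if all
cohomology vanishes). -/
noncomputable def kgrSeq (A : Type*) [CommRing A] (M : Type*) [AddCommGroup M]
    [Module A M] {n : ℕ} (x : Fin n → A) : ℕ∞ :=
  sInf {i : ℕ∞ | ∃ k : ℕ, i = k ∧ koszulCohomologyNeZero A M x k}

/-- The Koszul grade `kgr_A(𝔞, M)` of an arbitrary ideal `𝔞` on `M`: the supremum of the
Koszul grades of finite sequences contained in `𝔞` (equivalently, of the finitely
generated subideals of `𝔞`). -/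
noncomputable def kgr (A : Type*) [CommRing A] (𝔞 : Ideal A) (M : Type*)
    [AddCommGroup M] [Module A M] : ℕ∞ :=
  ⨆ (n : ℕ) (x : Fin n → A) (_ : ∀ j, x j ∈ 𝔞), kgrSeq A M x

/-- The height of an ideal: the infimum of the heights of the primes containing it. -/
noncomputable def idealHeight (A : Type*) [CommRing A] (𝔞 : Ideal A) : ℕ∞ :=
  ⨅ (p : PrimeSpectrum A) (_ : 𝔞 ≤ p.asIdeal), Order.height p

/-- A commutative ring `R` is Cohen-Macaulay in the sense of a class `𝒜` of ideals if
`height 𝔞 = kgr_R(𝔞, R)` for every `𝔞 ∈ 𝒜`. -/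
def IsCMSense (R : Type*) [CommRing R] (𝒜 : Set (Ideal R)) : Prop :=
  ∀ 𝔞 ∈ 𝒜, idealHeight R 𝔞 = kgr R 𝔞 R

/-- Cohen-Macaulay in the sense of ideals. -/
def IsCMIdeals (R : Type*) [CommRing R] : Prop :=
  ∀ 𝔞 : Ideal R, idealHeight R 𝔞 = kgr R 𝔞 R

/-- Cohen-Macaulay in the sense of maximal ideals. -/
def IsCMMaximal (R : Type*) [CommRing R] : Prop :=
  ∀ 𝔪 : Ideal R, 𝔪.IsMaximal → idealHeight R 𝔪 = kgr R 𝔪 R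

/-- The amalgamation `A ⋈^f J = {(a, f a + j) : a ∈ A, j ∈ J}` of `A` with `B` along the
ideal `J` of `B` with respect to `f : A →+* B`, as a subring of `A × B`. -/
def amalgamation {A B : Type*} [CommRing A] [CommRing B] (f : A →+* B) (J : Ideal B) :
    Subring (A × B) where
  carrier := {p | p.2 - f p.1 ∈ J}
  zero_mem' := by simp
  one_mem' := by simp
  add_mem' := fun {p q} hp hq => by
    have := J.add_mem hp hq
    simpa [add_sub_add_comm] using this
  neg_mem' := fun {p} hp => by
    show (-p).2 - f ((-p).1) ∈ J
    have key : (-p).2 - f ((-p).1) = -(p.2 - f p.1) := by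
      simp only [Prod.fst_neg, Prod.snd_neg, map_neg]; ring
    rw [key]
    exact J.neg_mem hp
  mul_mem' := fun {p q} hp hq => by
    show (p * q).2 - f ((p * q).1) ∈ J
    have key : (p * q).2 - f ((p * q).1)
        = p.2 * (q.2 - f q.1) + (p.2 - f p.1) * f q.1 := by
      simp only [Prod.fst_mul, Prod.snd_mul, map_mul]; ring
    rw [key]
    exact J.add_mem (J.mul_mem_left _ hq) (J.mul_mem_right _ hp)

/-- The natural embedding `ι_A : A → A ⋈^f J`, `a ↦ (a, f a)`. -/
def amalgIota {A B : Type*} [CommRing A] [CommRing B] (f : A →+* B) (J : Ideal B) :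
    A →+* amalgamation f J where
  toFun a := ⟨(a, f a), show (a, f a).2 - f (a, f a).1 ∈ J by simp⟩
  map_one' := Subtype.ext (by simp)
  map_mul' a b := Subtype.ext (by simp)
  map_zero' := Subtype.ext (by simp)
  map_add' a b := Subtype.ext (by simp)

/-- The extension `𝔞^e = 𝔞(A ⋈^f J)` of an ideal `𝔞` of `A` along `ι_A`. -/
noncomputable def idealExt {A B : Type*} [CommRing A] [CommRing B] (f : A →+* B)
    (J : Ideal B) (𝔞 : Ideal A) : Ideal ↥(amalgamation f J) :=
  Ideal.map (amalgIota f J) 𝔞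

/-- `kgr_A(𝔞, J)` where the ideal `J` of `B` is viewed as an `A`-module via `f`. -/
noncomputable def kgrIdeal {A B : Type*} [CommRing A] [CommRing B] (f : A →+* B)
    (J : Ideal B) (𝔞 : Ideal A) : ℕ∞ :=
  letI : Module A J := Module.compHom J f
  kgr A 𝔞 J

/-- The ideal `𝔭'^f = 𝔭 ⋈^f J = {(p, f p + j) : p ∈ 𝔭, j ∈ J}` of `A ⋈^f J`. -/
def primeAmalg {A B : Type*} [CommRing A] [CommRing B] (f : A →+* B) (J : Ideal B)
    (𝔭 : Ideal A) : Ideal ↥(amalgamation f J) where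
  carrier := {z | (z : A × B).1 ∈ 𝔭}
  zero_mem' := by simp
  add_mem' := fun {a b} ha hb => 𝔭.add_mem ha hb
  smul_mem' := fun c {z} hz => 𝔭.mul_mem_left (c : A × B).1 hz

/-- The ideal `𝔮̄^f = {(a, f a + j) : a ∈ A, j ∈ J, f a + j ∈ 𝔮}` of `A ⋈^f J`. -/
def qbarAmalg {A B : Type*} [CommRing A] [CommRing B] (f : A →+* B) (J : Ideal B)
    (𝔮 : Ideal B) : Ideal ↥(amalgamation f J) where
  carrier := {z | (z : A × B).2 ∈ 𝔮}
  zero_mem' := by simp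
  add_mem' := fun {a b} ha hb => 𝔮.add_mem ha hb
  smul_mem' := fun c {z} hz => 𝔮.mul_mem_left (c : A × B).2 hz

/-- A ring homomorphism `f : A →+* B` satisfies the going-down property. -/
def RingHom.GoesDown {A B : Type*} [CommRing A] [CommRing B] (f : A →+* B) : Prop :=
  ∀ (𝔭' 𝔭 : Ideal A), 𝔭'.IsPrime → 𝔭.IsPrime → 𝔭' ≤ 𝔭 →
    ∀ 𝔮 : Ideal B, 𝔮.IsPrime → 𝔮.comap f = 𝔭 →
      ∃ 𝔮' : Ideal B, 𝔮'.IsPrime ∧ 𝔮' ≤ 𝔮 ∧ 𝔮'.comap f = 𝔭'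

section Koszul

variable {A M ι : Type*} [CommRing A] [AddCommGroup M] [Module A M] [LinearOrder ι]

/-- The sign `(-1) ^ #{j ∈ s | j < k}`. -/
def koszulSign (A : Type*) [CommRing A] {ι : Type*} [LinearOrder ι] (k : ι) (s : Finset ι) : A :=
  (-1) ^ (s.filter (· < k)).card

/-- The Koszul differential, acting on all functions on finite subsets of the index type. -/
def koszulDiff (x : ι → A) (g : Finset ι → M) (t : Finset ι) : M :=
  ∑ j ∈ t, (koszulSign A j t * x j) • g (t.erase j)

/-- Vanishing of the `i`-th Koszul cohomology of the subfamily of `x` indexed by `S`. -/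
def KoszulVanishing (M : Type*) [AddCommGroup M] [Module A M] (x : ι → A) (S : Finset ι)
    (i : ℕ) : Prop :=
  ∀ g : Finset ι → M, (∀ t ⊆ S, t.card = i + 1 → koszulDiff x g t = 0) →
    ∃ h : Finset ι → M, ∀ t ⊆ S, t.card = i → koszulDiff x h t = g t

lemma koszulSign_mul_self (k : ι) (s : Finset ι) :
    koszulSign A k s * koszulSign A k s = 1 := by
  rw [koszulSign, ← mul_pow]; simp

lemma koszulSign_insert_of_lt {j k : ι} (h : j < k) {s : Finset ι} (hj : j ∉ s) :
    koszulSign A k (insert j s) = -koszulSign A k s := by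
  rw [koszulSign, koszulSign, Finset.filter_insert, if_pos h,
    Finset.card_insert_of_notMem, pow_succ]
  · ring
  · simp [hj]

lemma koszulSign_insert_of_not_lt {j k : ι} (h : ¬ j < k) (s : Finset ι) :
    koszulSign A k (insert j s) = koszulSign A k s := by
  rw [koszulSign, koszulSign, Finset.filter_insert, if_neg h]

lemma koszulDiff_congr (x : ι → A) {g h : Finset ι → M} {t : Finset ι}
    (H : ∀ j ∈ t, g (t.erase j) = h (t.erase j)) : koszulDiff x g t = koszulDiff x h t :=
  Finset.sum_congr rfl fun j hj => by rw [H j hj]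

lemma koszulDiff_add (x : ι → A) (g h : Finset ι → M) (t : Finset ι) :
    koszulDiff x (g + h) t = koszulDiff x g t + koszulDiff x h t := by
  simp [koszulDiff, Finset.sum_add_distrib]

lemma koszulDiff_smul (x : ι → A) (a : A) (g : Finset ι → M) (t : Finset ι) :
    koszulDiff x (a • g) t = a • koszulDiff x g t := by
  simp only [koszulDiff, Finset.smul_sum, Pi.smul_apply]
  exact Finset.sum_congr rfl fun j _ => smul_comm _ _ _

lemma koszulDiff_neg (x : ι → A) (g : Finset ι → M) (t : Finset ι) :
    koszulDiff x (-g) t = -koszulDiff x g t := by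
  simp [koszulDiff]

lemma koszulDiff_sub (x : ι → A) (g h : Finset ι → M) (t : Finset ι) :
    koszulDiff x (g - h) t = koszulDiff x g t - koszulDiff x h t := by
  rw [sub_eq_add_neg, koszulDiff_add, koszulDiff_neg, sub_eq_add_neg]

lemma koszulDiff_zero (x : ι → A) (t : Finset ι) :
    koszulDiff x (0 : Finset ι → M) t = 0 := by
  simp [koszulDiff]

/-- The cochain with component `g₀` on sets avoiding `k` and component `g₁` (up to sign) on
sets containing `k`. -/
def koszulGlue (A : Type*) [CommRing A] {M ι : Type*} [AddCommGroup M] [Module A M]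
    [LinearOrder ι] (k : ι) (g₀ g₁ : Finset ι → M) (t : Finset ι) : M :=
  if k ∈ t then koszulSign A k (t.erase k) • g₁ (t.erase k) else g₀ t

/-- The component of a cochain on sets containing `k`. -/
def koszulSlice (A : Type*) [CommRing A] {M ι : Type*} [AddCommGroup M] [Module A M]
    [LinearOrder ι] (k : ι) (g : Finset ι → M) (t : Finset ι) : M :=
  koszulSign A k t • g (insert k t)

lemma koszulGlue_insert {k : ι} {t : Finset ι} (hk : k ∉ t) (g₀ g₁ : Finset ι → M) :
    koszulGlue A k g₀ g₁ (insert k t) = koszulSign A k t • g₁ t := by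
  simp [koszulGlue, Finset.erase_insert hk]

lemma koszulGlue_slice (k : ι) (g : Finset ι → M) :
    koszulGlue A k g (koszulSlice A k g) = g := by
  ext t
  by_cases hk : k ∈ t
  · simp [koszulGlue, hk, koszulSlice, smul_smul, koszulSign_mul_self, Finset.insert_erase]
  · simp [koszulGlue, hk]

lemma koszulDiff_glue_of_notMem (x : ι → A) {k : ι} {t : Finset ι} (hk : k ∉ t)
    (g₀ g₁ : Finset ι → M) : koszulDiff x (koszulGlue A k g₀ g₁) t = koszulDiff x g₀ t :=
  koszulDiff_congr x fun j _ => by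
    rw [koszulGlue, if_neg fun h => hk (Finset.mem_of_mem_erase h)]

lemma koszulDiff_glue_insert (x : ι → A) {k : ι} {t : Finset ι} (hk : k ∉ t)
    (g₀ g₁ : Finset ι → M) : koszulDiff x (koszulGlue A k g₀ g₁) (insert k t) =
      koszulSign A k t • (x k • g₀ t - koszulDiff x g₁ t) := by
  rw [koszulDiff, Finset.sum_insert hk, Finset.erase_insert hk, koszulGlue, if_neg hk,
    koszulSign_insert_of_not_lt (lt_irrefl k), smul_sub, smul_smul, sub_eq_add_neg]
  congr 1
  rw [koszulDiff, Finset.smul_sum, ← Finset.sum_neg_distrib]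
  refine Finset.sum_congr rfl fun j hj => ?_
  have hjk : j ≠ k := fun h => hk (h ▸ hj)
  have hk' : k ∉ t.erase j := fun h => hk (Finset.mem_of_mem_erase h)
  rw [Finset.erase_insert_of_ne hjk.symm, koszulGlue_insert hk', smul_smul, smul_smul, ← neg_smul]
  congr 1
  rcases lt_or_gt_of_ne hjk with h | h
  · rw [koszulSign_insert_of_not_lt h.not_gt]
    conv_rhs => rw [← Finset.insert_erase hj, koszulSign_insert_of_lt h (Finset.notMem_erase j t)]
    rw [Finset.insert_erase hj]; ring
  · rw [koszulSign_insert_of_lt h hk]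
    conv_rhs => rw [← Finset.insert_erase hj, koszulSign_insert_of_not_lt h.not_gt]
    rw [Finset.insert_erase hj]; ring

/-- Slices of cocycles satisfy the cone relation. -/
lemma koszulDiff_slice (x : ι → A) {k : ι} {t : Finset ι} (hk : k ∉ t) (g : Finset ι → M)
    (h : koszulDiff x g (insert k t) = 0) :
    koszulDiff x (koszulSlice A k g) t = x k • g t := by
  rw [← koszulGlue_slice (A := A) k g, koszulDiff_glue_insert x hk] at h
  have h' := congrArg (koszulSign A k t • ·) h
  simp only [smul_smul, koszulSign_mul_self, one_smul, smul_zero] at h'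
  exact (sub_eq_zero.mp h').symm

lemma KoszulVanishing.insert_index {x : ι → A} {S : Finset ι} {k : ι} (hk : k ∉ S) {i : ℕ}
    (h : ∀ m ≤ i, KoszulVanishing M x S m) : KoszulVanishing M x (insert k S) i := by
  intro g hg
  obtain ⟨h₀, hh₀⟩ := h i le_rfl g fun t ht => hg t (ht.trans (Finset.subset_insert k S))
  have key : ∃ u : Finset ι → M, ∀ t ⊆ S, t.card + 1 = i →
      koszulDiff x u t = koszulSlice A k g t - x k • h₀ t := by
    cases i with
    | zero => exact ⟨0, fun t _ ht => by omega⟩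
    | succ m =>
      obtain ⟨u, hu⟩ := h m (Nat.le_succ m) (koszulSlice A k g - x k • h₀) fun t ht hc => by
        have hkt : k ∉ t := fun h => hk (ht h)
        rw [koszulDiff_sub, koszulDiff_smul, hh₀ t ht hc, koszulDiff_slice x hkt g, sub_self]
        exact hg _ (Finset.insert_subset_insert k ht) (by rw [Finset.card_insert_of_notMem hkt, hc])
      exact ⟨u, fun t ht hc => hu t ht (by omega)⟩
  obtain ⟨u, hu⟩ := key
  refine ⟨koszulGlue A k h₀ (-u), fun t ht hc => ?_⟩
  by_cases hkt : k ∈ t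
  · obtain ⟨s, hks, rfl⟩ : ∃ s, k ∉ s ∧ insert k s = t :=
      ⟨t.erase k, Finset.notMem_erase k t, Finset.insert_erase hkt⟩
    have hs : s ⊆ S := (Finset.insert_subset_insert_iff hks).mp ht
    rw [Finset.card_insert_of_notMem hks] at hc
    rw [koszulDiff_glue_insert x hks, koszulDiff_neg, hu s hs hc, koszulSlice]
    simp [smul_smul, koszulSign_mul_self]
  · rw [koszulDiff_glue_of_notMem x hkt, hh₀ t ((Finset.subset_insert_iff_of_notMem hkt).mp ht) hc]

/-- If the cohomology of `insert k S` vanishes, then `x k` is injective on that of `S`. -/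
lemma KoszulVanishing.exists_of_smul {x : ι → A} {S : Finset ι} {k : ι} (hk : k ∉ S) {i : ℕ}
    (h : KoszulVanishing M x (insert k S) i) {g : Finset ι → M}
    (hg : ∀ t ⊆ S, t.card = i + 1 → koszulDiff x g t = 0)
    (hx : ∃ u : Finset ι → M, ∀ t ⊆ S, t.card = i → koszulDiff x u t = x k • g t) :
    ∃ u : Finset ι → M, ∀ t ⊆ S, t.card = i → koszulDiff x u t = g t := by
  obtain ⟨u, hu⟩ := hx
  obtain ⟨v, hv⟩ := h (koszulGlue A k g u) fun t ht hc => by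
    by_cases hkt : k ∈ t
    · obtain ⟨s, hks, rfl⟩ : ∃ s, k ∉ s ∧ insert k s = t :=
        ⟨t.erase k, Finset.notMem_erase k t, Finset.insert_erase hkt⟩
      rw [Finset.card_insert_of_notMem hks] at hc
      rw [koszulDiff_glue_insert x hks, hu s ((Finset.insert_subset_insert_iff hks).mp ht)
        (by omega), sub_self, smul_zero]
    · rw [koszulDiff_glue_of_notMem x hkt,
        hg t ((Finset.subset_insert_iff_of_notMem hkt).mp ht) hc]
  refine ⟨v, fun t ht hc => ?_⟩
  rw [hv t (ht.trans (Finset.subset_insert k S)) hc, koszulGlue, if_neg fun h => hk (ht h)]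

/-- The ideal generated by a family annihilates its Koszul cohomology. -/
lemma exists_koszulDiff_eq_smul {x : ι → A} {S : Finset ι} {i : ℕ} {g : Finset ι → M}
    (hg : ∀ t ⊆ S, t.card = i + 1 → koszulDiff x g t = 0) {y : A}
    (hy : y ∈ Ideal.span (x '' S)) :
    ∃ u : Finset ι → M, ∀ t ⊆ S, t.card = i → koszulDiff x u t = y • g t := by
  induction hy using Submodule.span_induction with
  | mem y hy =>
    obtain ⟨k, hk, rfl⟩ := hy
    refine ⟨koszulGlue A k (koszulSlice A k g) 0, fun t ht hc => ?_⟩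
    by_cases hkt : k ∈ t
    · obtain ⟨s, hks, rfl⟩ : ∃ s, k ∉ s ∧ insert k s = t :=
        ⟨t.erase k, Finset.notMem_erase k t, Finset.insert_erase hkt⟩
      rw [koszulDiff_glue_insert x hks, koszulDiff_zero, sub_zero, koszulSlice, smul_smul,
        smul_smul, mul_right_comm, koszulSign_mul_self, one_mul]
    · rw [koszulDiff_glue_of_notMem x hkt, koszulDiff_slice x hkt g]
      exact hg _ (Finset.insert_subset hk ht) (by rw [Finset.card_insert_of_notMem hkt, hc])
  | zero => exact ⟨0, fun t _ _ => by rw [koszulDiff_zero, zero_smul]⟩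
  | add a b _ _ ha hb =>
    obtain ⟨u, hu⟩ := ha
    obtain ⟨v, hv⟩ := hb
    exact ⟨u + v, fun t ht hc => by rw [koszulDiff_add, hu t ht hc, hv t ht hc, add_smul]⟩
  | smul a b _ hb =>
    obtain ⟨u, hu⟩ := hb
    exact ⟨a • u, fun t ht hc => by rw [koszulDiff_smul, hu t ht hc, smul_assoc]⟩

lemma KoszulVanishing.of_insert_index {x : ι → A} {S : Finset ι} {k : ι}
    (hx : x k ∈ (Ideal.span (x '' S)).radical) {i : ℕ}
    (h : KoszulVanishing M x (insert k S) i) : KoszulVanishing M x S i := by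
  by_cases hk : k ∈ S
  · rwa [Finset.insert_eq_of_mem hk] at h
  intro g hg
  obtain ⟨N, hN⟩ := hx
  have hpow : ∀ n : ℕ,
      (∃ u : Finset ι → M, ∀ t ⊆ S, t.card = i → koszulDiff x u t = x k ^ n • g t) →
      ∃ u : Finset ι → M, ∀ t ⊆ S, t.card = i → koszulDiff x u t = g t := by
    intro n
    induction n with
    | zero => simp
    | succ n ih =>
      rintro ⟨u, hu⟩
      refine ih (h.exists_of_smul hk (g := x k ^ n • g) (fun t ht hc => ?_)
        ⟨u, fun t ht hc => ?_⟩)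
      · rw [koszulDiff_smul, hg t ht hc, smul_zero]
      · rw [hu t ht hc, Pi.smul_apply, smul_smul, pow_succ']
  exact hpow N (exists_koszulDiff_eq_smul hg hN)

lemma KoszulVanishing.union {x : ι → A} {S T : Finset ι} {r : ℕ}
    (h : ∀ m < r, KoszulVanishing M x S m) : ∀ m < r, KoszulVanishing M x (T ∪ S) m := by
  induction T using Finset.induction_on with
  | empty => simpa using h
  | insert k T _ ih =>
    rw [Finset.insert_union]
    by_cases hk : k ∈ T ∪ S
    · rwa [Finset.insert_eq_of_mem hk]
    · exact fun m hm => .insert_index hk fun l hl => ih l (hl.trans_lt hm)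

lemma KoszulVanishing.of_union {x : ι → A} {S T : Finset ι}
    (hx : ∀ k ∈ T, x k ∈ (Ideal.span (x '' S)).radical) {i : ℕ}
    (h : KoszulVanishing M x (T ∪ S) i) : KoszulVanishing M x S i := by
  induction T using Finset.induction_on with
  | empty => simpa using h
  | insert k T _ ih =>
    rw [Finset.insert_union] at h
    refine ih (fun j hj => hx j (Finset.mem_insert_of_mem hj)) (h.of_insert_index ?_)
    refine Ideal.radical_mono (Ideal.span_mono (Set.image_mono ?_))
      (hx k (Finset.mem_insert_self k T))
    exact_mod_cast Finset.subset_union_right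

lemma koszulDiff_comp_map {κ : Type*} [LinearOrder κ] (e : ι ↪o κ) (z : κ → A)
    (g : Finset κ → M) (t : Finset ι) :
    koszulDiff (z ∘ e) (fun s => g (s.map e.toEmbedding)) t =
      koszulDiff z g (t.map e.toEmbedding) := by
  rw [koszulDiff, koszulDiff, Finset.sum_map]
  refine Finset.sum_congr rfl fun j _ => ?_
  rw [Finset.map_erase, koszulSign, koszulSign, Finset.filter_map, Finset.card_map]
  simp

lemma koszulVanishing_comp {κ : Type*} [LinearOrder κ] (e : ι ↪o κ) (z : κ → A)
    (S : Finset ι) (i : ℕ) :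
    KoszulVanishing M (z ∘ e) S i ↔ KoszulVanishing M z (S.map e.toEmbedding) i := by
  have ext (g : Finset ι → M) :
      ∃ G : Finset κ → M, g = fun s => G (s.map e.toEmbedding) :=
    ⟨Function.extend (Finset.map e.toEmbedding) g 0,
      funext fun s => ((Finset.map_injective e.toEmbedding).extend_apply g 0 s).symm⟩
  constructor
  · intro h g hg
    obtain ⟨u, hu⟩ := h (fun s => g (s.map e.toEmbedding)) fun t ht hc => by
      rw [koszulDiff_comp_map]
      exact hg _ (Finset.map_subset_map.mpr ht) (by rwa [Finset.card_map])
    obtain ⟨U, rfl⟩ := ext u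
    refine ⟨U, fun t ht hc => ?_⟩
    obtain ⟨s, hs, rfl⟩ := Finset.subset_map_iff.mp ht
    rw [← koszulDiff_comp_map]
    exact hu s hs (by rwa [Finset.card_map] at hc)
  · intro h g hg
    obtain ⟨G, rfl⟩ := ext g
    obtain ⟨U, hU⟩ := h G fun t ht hc => by
      obtain ⟨s, hs, rfl⟩ := Finset.subset_map_iff.mp ht
      rw [← koszulDiff_comp_map]
      exact hg s hs (by rwa [Finset.card_map] at hc)
    refine ⟨fun s => U (s.map e.toEmbedding), fun t ht hc => ?_⟩
    rw [koszulDiff_comp_map]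
    exact hU _ (Finset.map_subset_map.mpr ht) (by rwa [Finset.card_map])

/-- Koszul vanishing in low degrees passes to sequences generating a larger ideal up to
radical. -/
lemma KoszulVanishing.mono {n m : ℕ} {x : Fin n → A} {y : Fin m → A}
    (hxy : ∀ j, x j ∈ (Ideal.span (Set.range y)).radical) {r : ℕ}
    (h : ∀ k < r, KoszulVanishing M x Finset.univ k) :
    ∀ k < r, KoszulVanishing M y Finset.univ k := by
  have hx : Fin.append x y ∘ Fin.castAddOrderEmb m = x := by
    ext j; simp
  have hy : Fin.append x y ∘ Fin.natAddOrderEmb n = y := by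
    ext j; simp
  intro k hk
  rw [← hy, koszulVanishing_comp]
  refine KoszulVanishing.of_union
    (T := Finset.univ.map (Fin.castAddOrderEmb m (n := n)).toEmbedding) ?_ ?_
  · intro j hj
    obtain ⟨l, -, rfl⟩ := Finset.mem_map.mp hj
    have hrange : Fin.append x y '' (Finset.univ.map (Fin.natAddOrderEmb n (m := m)).toEmbedding) =
        Set.range y := by
      rw [Finset.coe_map, Finset.coe_univ, Set.image_univ]
      exact (Set.range_comp _ _).symm.trans (congrArg Set.range hy)
    rw [hrange]
    convert hxy l using 1
    exact congrFun hx l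
  · rw [Finset.union_comm]
    refine KoszulVanishing.union (fun l hl => ?_) k hk
    rw [← koszulVanishing_comp, hx]
    exact h l hl

lemma map_koszulDiff {R N : Type*} [CommRing R] [AddCommGroup N] [Module R N] (φ : A →+* R)
    (e : M →+ N) (he : ∀ a m, e (a • m) = φ a • e m) (x : ι → A) (g : Finset ι → M)
    (t : Finset ι) : e (koszulDiff x g t) = koszulDiff (φ ∘ x) (e ∘ g) t := by
  simp [koszulDiff, he, koszulSign]

lemma koszulVanishing_congr {R N : Type*} [CommRing R] [AddCommGroup N] [Module R N]
    (φ : A →+* R) (e : M ≃+ N) (he : ∀ a m, e (a • m) = φ a • e m) (x : ι → A)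
    (S : Finset ι) (i : ℕ) : KoszulVanishing M x S i ↔ KoszulVanishing N (φ ∘ x) S i := by
  have key (g : Finset ι → M) (t : Finset ι) :
      e (koszulDiff x g t) = koszulDiff (φ ∘ x) (e ∘ g) t :=
    map_koszulDiff φ (e : M →+ N) he x g t
  constructor
  · intro h g hg
    have hg' : e ∘ (e.symm ∘ g) = g := by ext; simp
    obtain ⟨u, hu⟩ := h (e.symm ∘ g) fun t ht hc => by
      apply e.injective
      rw [key, hg', hg t ht hc, map_zero]
    exact ⟨e ∘ u, fun t ht hc => by rw [← key, hu t ht hc]; simp⟩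
  · intro h g hg
    obtain ⟨u, hu⟩ := h (e ∘ g) fun t ht hc => by rw [← key, hg t ht hc, map_zero]
    have hu' : e ∘ (e.symm ∘ u) = u := by ext; simp
    refine ⟨e.symm ∘ u, fun t ht hc => e.injective ?_⟩
    rw [key, hu', hu t ht hc]; rfl

lemma koszulVanishing_prod {N : Type*} [AddCommGroup N] [Module A N] (x : ι → A)
    (S : Finset ι) (i : ℕ) :
    KoszulVanishing (M × N) x S i ↔ KoszulVanishing M x S i ∧ KoszulVanishing N x S i := by
  have key₁ (g : Finset ι → M × N) (t : Finset ι) :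
      (koszulDiff x g t).1 = koszulDiff x (fun s => (g s).1) t := by
    simp [koszulDiff, Prod.fst_sum]
  have key₂ (g : Finset ι → M × N) (t : Finset ι) :
      (koszulDiff x g t).2 = koszulDiff x (fun s => (g s).2) t := by
    simp [koszulDiff, Prod.snd_sum]
  refine ⟨fun h => ⟨fun g hg => ?_, fun g hg => ?_⟩, fun ⟨h₁, h₂⟩ g hg => ?_⟩
  · obtain ⟨u, hu⟩ := h (fun s => (g s, 0)) fun t ht hc =>
      Prod.ext ((key₁ _ t).trans (hg t ht hc)) ((key₂ _ t).trans (koszulDiff_zero x t))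
    exact ⟨fun s => (u s).1, fun t ht hc => by rw [← key₁, hu t ht hc]⟩
  · obtain ⟨u, hu⟩ := h (fun s => (0, g s)) fun t ht hc =>
      Prod.ext ((key₁ _ t).trans (koszulDiff_zero x t)) ((key₂ _ t).trans (hg t ht hc))
    exact ⟨fun s => (u s).2, fun t ht hc => by rw [← key₂, hu t ht hc]⟩
  · obtain ⟨u, hu⟩ := h₁ (fun s => (g s).1) fun t ht hc => by rw [← key₁, hg t ht hc]; rfl
    obtain ⟨v, hv⟩ := h₂ (fun s => (g s).2) fun t ht hc => by rw [← key₂, hg t ht hc]; rfl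
    exact ⟨fun s => (u s, v s), fun t ht hc =>
      Prod.ext ((key₁ _ t).trans (hu t ht hc)) ((key₂ _ t).trans (hv t ht hc))⟩

lemma KoszulVanishing.localization [Finite ι] (P : Submonoid A) (R : Type*) [CommRing R]
    [Algebra A R] [IsLocalization P R] {x : ι → A} {S : Finset ι} {i : ℕ}
    (h : KoszulVanishing A x S i) : KoszulVanishing R (algebraMap A R ∘ x) S i := by
  cases nonempty_fintype ι
  have key (g : Finset ι → A) (t : Finset ι) :
      algebraMap A R (koszulDiff x g t) = koszulDiff (algebraMap A R ∘ x) (algebraMap A R ∘ g) t :=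
    map_koszulDiff (algebraMap A R) (algebraMap A R : A →+ R) (by simp) x g t
  intro g hg
  obtain ⟨b, hb⟩ := IsLocalization.exist_integer_multiples_of_finite P g
  choose g' hg' using hb
  have hg'' : algebraMap A R ∘ g' = algebraMap A R b • g := by
    ext t; simp [hg', Algebra.smul_def]
  have hc : ∃ c : P, ∀ t ⊆ S, t.card = i + 1 → koszulDiff x ((c : A) • g') t = 0 := by
    have hex : ∀ t : Finset ι, ∃ c : P, t ⊆ S → t.card = i + 1 →
        (c : A) * koszulDiff x g' t = 0 := by
      intro t
      by_cases ht : t ⊆ S ∧ t.card = i + 1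
      · have : algebraMap A R (koszulDiff x g' t) = 0 := by
          rw [key, hg'', koszulDiff_smul, hg t ht.1 ht.2, smul_zero]
        obtain ⟨c, hc⟩ := (IsLocalization.map_eq_zero_iff P R _).mp this
        exact ⟨c, fun _ _ => hc⟩
      · exact ⟨1, fun h₁ h₂ => absurd ⟨h₁, h₂⟩ ht⟩
    choose c hc using hex
    refine ⟨∏ t, c t, fun t ht hcard => ?_⟩
    rw [koszulDiff_smul, ← Finset.mul_prod_erase Finset.univ c (Finset.mem_univ t),
      Submonoid.coe_mul, mul_comm, mul_smul, smul_eq_mul (c t : A), hc t ht hcard, smul_zero]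
  obtain ⟨c, hc⟩ := hc
  obtain ⟨u, hu⟩ := h _ hc
  refine ⟨IsLocalization.mk' R 1 (c * b) • (algebraMap A R ∘ u), fun t ht hcard => ?_⟩
  rw [koszulDiff_smul, ← key, hu t ht hcard]
  have : algebraMap A R (g' t) = algebraMap A R b * g t := congrFun hg'' t
  rw [Pi.smul_apply, smul_eq_mul, smul_eq_mul, map_mul, this, ← mul_assoc, ← mul_assoc,
    mul_assoc (IsLocalization.mk' R 1 (c * b)), ← map_mul, ← Submonoid.coe_mul,
    IsLocalization.mk'_spec, map_one, one_mul]

end Koszul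

section KoszulGrade

variable {A : Type*} [CommRing A]

lemma koszulMap_restrict {M : Type*} [AddCommGroup M] [Module A M] {n : ℕ} (x : Fin n → A)
    (i : ℕ) (g : Finset (Fin n) → M) (t : {s : Finset (Fin n) // s.card = i + 1}) :
    koszulMap A M x i (fun s => g s.1) t = koszulDiff x g t.1 :=
  Finset.sum_attach t.1 fun j => (koszulSign A j t.1 * x j) • g (t.1.erase j)

lemma koszulCohomologyNeZero_iff (M : Type*) [AddCommGroup M] [Module A M] {n : ℕ}
    (x : Fin n → A) (i : ℕ) :
    koszulCohomologyNeZero A M x i ↔ ¬ KoszulVanishing M x Finset.univ i := by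
  have ext {i : ℕ} (g : {s : Finset (Fin n) // s.card = i} → M) :
      ∃ G : Finset (Fin n) → M, g = fun s => G s.1 :=
    ⟨fun s => if h : s.card = i then g ⟨s, h⟩ else 0, funext fun s => by simp [s.2]⟩
  have ker {i : ℕ} (g : Finset (Fin n) → M) :
      (fun s => g s.1) ∈ LinearMap.ker (koszulMap A M x i) ↔
        ∀ t ⊆ Finset.univ, t.card = i + 1 → koszulDiff x g t = 0 := by
    rw [LinearMap.mem_ker]
    refine ⟨fun h t _ hc => ?_, fun h => funext fun t => ?_⟩
    · rw [← koszulMap_restrict x i g ⟨t, hc⟩, h]; rfl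
    · rw [koszulMap_restrict, h t.1 (Finset.subset_univ _) t.2]; rfl
  cases i with
  | zero =>
    rw [koszulCohomologyNeZero, ne_eq, not_iff_not, Submodule.eq_bot_iff]
    constructor
    · intro h g hg
      have := h _ ((ker g).mpr hg)
      refine ⟨0, fun t _ hc => ?_⟩
      rw [koszulDiff_zero]
      exact (congrFun this ⟨t, hc⟩).symm
    · intro h g hg
      obtain ⟨g, rfl⟩ := ext g
      obtain ⟨u, hu⟩ := h g ((ker g).mp hg)
      refine funext fun t => ?_
      rw [← hu t.1 (Finset.subset_univ _) t.2, Finset.card_eq_zero.mp t.2]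
      simp [koszulDiff]
  | succ i =>
    rw [koszulCohomologyNeZero, not_iff_not]
    constructor
    · intro h g hg
      obtain ⟨u, hu⟩ := h ((ker g).mpr hg)
      obtain ⟨u, rfl⟩ := ext u
      refine ⟨u, fun t _ hc => ?_⟩
      rw [← koszulMap_restrict x i u ⟨t, hc⟩, hu]
    · intro h g hg
      obtain ⟨g, rfl⟩ := ext g
      obtain ⟨u, hu⟩ := h g ((ker g).mp hg)
      refine ⟨fun s => u s.1, funext fun t => ?_⟩
      rw [koszulMap_restrict, hu t.1 (Finset.subset_univ _) t.2]

lemma natCast_le_kgrSeq_iff (M : Type*) [AddCommGroup M] [Module A M] {n : ℕ} (x : Fin n → A)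
    (r : ℕ) : (r : ℕ∞) ≤ kgrSeq A M x ↔ ∀ k < r, KoszulVanishing M x Finset.univ k := by
  rw [kgrSeq, le_sInf_iff]
  constructor
  · intro h k hk
    by_contra hv
    have := h k ⟨k, rfl, (koszulCohomologyNeZero_iff M x k).mpr hv⟩
    exact absurd (Nat.cast_le.mp this) (by omega)
  · rintro h _ ⟨k, rfl, hk⟩
    by_contra hlt
    exact (koszulCohomologyNeZero_iff M x k).mp hk (h k (by simpa using hlt))

lemma natCast_le_kgr_iff (𝔞 : Ideal A) (M : Type*) [AddCommGroup M] [Module A M] (r : ℕ) :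
    (r : ℕ∞) ≤ kgr A 𝔞 M ↔ ∃ (n : ℕ) (x : Fin n → A), (∀ j, x j ∈ 𝔞) ∧
      ∀ k < r, KoszulVanishing M x Finset.univ k := by
  simp only [← natCast_le_kgrSeq_iff]
  constructor
  · intro h
    cases r with
    | zero => exact ⟨0, Fin.elim0, fun j => j.elim0, by simp⟩
    | succ r =>
      have hlt : (r : ℕ∞) < kgr A 𝔞 M := lt_of_lt_of_le (by exact_mod_cast r.lt_succ_self) h
      simp only [kgr, lt_iSup_iff] at hlt
      obtain ⟨n, x, hx, hr⟩ := hlt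
      exact ⟨n, x, hx, by simpa using Order.add_one_le_of_lt hr⟩
  · rintro ⟨n, x, hx, hr⟩
    exact hr.trans (le_iSup_of_le n (le_iSup_of_le x (le_iSup_of_le hx le_rfl)))

lemma kgr_prod (𝔞 : Ideal A) (M N : Type*) [AddCommGroup M] [Module A M] [AddCommGroup N]
    [Module A N] : kgr A 𝔞 (M × N) = min (kgr A 𝔞 M) (kgr A 𝔞 N) := by
  refine ENat.eq_of_forall_natCast_le_iff fun r => ?_
  rw [le_min_iff]
  simp only [natCast_le_kgr_iff, koszulVanishing_prod]
  constructor
  · rintro ⟨n, x, hx, h⟩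
    exact ⟨⟨n, x, hx, fun k hk => (h k hk).1⟩, ⟨n, x, hx, fun k hk => (h k hk).2⟩⟩
  · rintro ⟨⟨n, x, hx, h⟩, ⟨m, y, hy, h'⟩⟩
    refine ⟨n + m, Fin.append x y, fun j => ?_, fun k hk => ⟨?_, ?_⟩⟩
    · induction j using Fin.addCases <;> simp [hx, hy]
    · refine KoszulVanishing.mono (fun j => Ideal.le_radical (Ideal.subset_span ?_)) h k hk
      exact ⟨Fin.castAdd m j, by simp⟩
    · refine KoszulVanishing.mono (fun j => Ideal.le_radical (Ideal.subset_span ?_)) h' k hk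
      exact ⟨Fin.natAdd n j, by simp⟩

/-- A finite family in the radical of `span s` lies in the radical of the ideal generated by a
finite family in `s`. -/
lemma exists_fin_mem_radical_span {R : Type*} [CommRing R] {s : Set R} {n : ℕ} (x : Fin n → R)
    (hx : ∀ j, x j ∈ (Ideal.span s).radical) :
    ∃ (m : ℕ) (y : Fin m → R), (∀ l, y l ∈ s) ∧
      ∀ j, x j ∈ (Ideal.span (Set.range y)).radical := by
  have h : ∀ j, ∃ T : Finset R, (T : Set R) ⊆ s ∧ x j ∈ (Ideal.span (T : Set R)).radical := by
    intro j
    obtain ⟨N, hN⟩ := hx j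
    obtain ⟨T, hT, hN⟩ := Submodule.mem_span_finite_of_mem_span hN
    exact ⟨T, hT, N, hN⟩
  choose T hT hxT using h
  classical
  let U : Finset R := Finset.univ.biUnion T
  refine ⟨U.card, fun l => (U.equivFin.symm l).1, fun l => ?_, fun j => ?_⟩
  · obtain ⟨j, -, hj⟩ := Finset.mem_biUnion.mp (U.equivFin.symm l).2
    exact hT j hj
  · refine Ideal.radical_mono (Ideal.span_mono fun a ha => ?_) (hxT j)
    exact ⟨U.equivFin ⟨a, Finset.mem_biUnion.mpr ⟨j, Finset.mem_univ j, ha⟩⟩, by simp⟩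

/-- Koszul grade is invariant under restriction of scalars, and depends only on the radical. -/
lemma kgr_eq_of_radical_eq_map {R M N : Type*} [CommRing R] [AddCommGroup M] [Module A M]
    [AddCommGroup N] [Module R N] (φ : A →+* R) (e : M ≃+ N)
    (he : ∀ a m, e (a • m) = φ a • e m) {𝔞 : Ideal A} {𝔟 : Ideal R}
    (h : 𝔟.radical = (𝔞.map φ).radical) : kgr R 𝔟 N = kgr A 𝔞 M := by
  refine ENat.eq_of_forall_natCast_le_iff fun r => ?_
  simp only [natCast_le_kgr_iff, koszulVanishing_congr φ e he]
  constructor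
  · rintro ⟨n, x, hx, hr⟩
    obtain ⟨m, y, hy, hxy⟩ := exists_fin_mem_radical_span (s := φ '' 𝔞) x fun j =>
      h.le (Ideal.le_radical (hx j))
    choose z hz hzy using hy
    obtain rfl : φ ∘ z = y := funext hzy
    exact ⟨m, z, hz, KoszulVanishing.mono hxy hr⟩
  · rintro ⟨n, x, hx, hr⟩
    obtain ⟨m, y, hy, hxy⟩ := exists_fin_mem_radical_span (s := 𝔟) (φ ∘ x) fun j => by
      rw [Ideal.span_eq, h]
      exact Ideal.le_radical (Ideal.mem_map_of_mem φ (hx j))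
    exact ⟨m, y, hy, KoszulVanishing.mono hxy hr⟩

/-- Kronecker's theorem, in the form of Coquand: if all chains of primes containing `I` and
avoiding `a` have length less than `n`, then `n` elements `b` can be modified by multiples of `a`
so that `a` lies in the radical of the ideal they generate together with `I`. -/
lemma exists_mem_radical_sup_span_add_mul (a : A) (n : ℕ) : ∀ (I : Ideal A) (b : Fin n → A),
    (∀ l : LTSeries (PrimeSpectrum A), I ≤ l.head.asIdeal → a ∉ l.last.asIdeal → l.length < n) →
    ∃ c : Fin n → A, a ∈ (I ⊔ Ideal.span (Set.range fun i => b i + a * c i)).radical := by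
  induction n with
  | zero =>
    intro I b h
    refine ⟨Fin.elim0, Ideal.radical_mono le_sup_left ?_⟩
    rw [Ideal.radical_eq_sInf, Ideal.mem_sInf]
    rintro P ⟨hIP, hP⟩
    by_contra haP
    exact absurd (h (RelSeries.singleton _ ⟨P, hP⟩) hIP haP) (Nat.not_lt_zero _)
  | succ n ih =>
    intro I b h
    let K : Ideal A := Submodule.comap (LinearMap.mulRight A (b 0)) I.radical
    have hK (s : A) : s ∈ K ↔ s * b 0 ∈ I.radical := Iff.rfl
    obtain ⟨c, hc⟩ := ih (I ⊔ Ideal.span {b 0} ⊔ K) (fun i => b i.succ) (by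
      intro l hl hal
      have hIP : I ≤ l.head.asIdeal := le_sup_left.trans (le_sup_left.trans hl)
      have hbP : b 0 ∈ l.head.asIdeal :=
        hl (Ideal.mem_sup_left (Ideal.mem_sup_right (Ideal.mem_span_singleton_self _)))
      have hKP : K ≤ l.head.asIdeal := le_sup_right.trans hl
      obtain ⟨Q, hQI, hQ⟩ : ∃ Q : PrimeSpectrum A, I ≤ Q.asIdeal ∧ Q < l.head := by
        have hdisj : Disjoint (I : Set A)
            (l.head.asIdeal.primeCompl ⊔ Submonoid.powers (b 0) : Submonoid A) := by
          rw [Set.disjoint_left]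
          intro z hzI hz
          obtain ⟨s, hs, _, ⟨N, rfl⟩, rfl⟩ := Submonoid.mem_sup.mp hz
          refine hs (hKP ((hK s).mpr ⟨N + 1, ?_⟩))
          have : (s * b 0) ^ (N + 1) = (s ^ N * b 0) * (s * b 0 ^ N) := by ring
          rw [this]
          exact I.mul_mem_left _ hzI
        obtain ⟨Q, hQ, hIQ, hQd⟩ := I.exists_le_prime_disjoint _ hdisj
        rw [Set.disjoint_left] at hQd
        refine ⟨⟨Q, hQ⟩, hIQ, lt_of_le_of_ne (fun z hz => ?_) fun h => ?_⟩
        · by_contra hzP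
          exact hQd hz (Submonoid.mem_sup_left hzP)
        · exact hQd ((congrArg PrimeSpectrum.asIdeal h).ge hbP)
            (Submonoid.mem_sup_right (Submonoid.mem_powers (b 0)))
      have := h (l.cons Q hQ) (by simpa using hQI) (by simpa using hal)
      simpa using this)
    obtain ⟨k, hk⟩ := hc
    obtain ⟨u, hu, v, hv, huv⟩ := Submodule.mem_sup.mp hk
    obtain ⟨w, hw, s, hs, rfl⟩ := Submodule.mem_sup.mp hu
    refine ⟨Fin.cons s c, ?_⟩
    rw [Ideal.radical_eq_sInf, Ideal.mem_sInf]
    rintro P ⟨hP, hPp⟩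
    have hIP : I ≤ P := le_sup_left.trans hP
    have hgen (i : Fin (n + 1)) : b i + a * (Fin.cons s c : Fin (n + 1) → A) i ∈ P :=
      hP (Ideal.mem_sup_right (Ideal.subset_span ⟨i, rfl⟩))
    have h0 : b 0 + a * s ∈ P := by simpa using hgen 0
    have hvP : v ∈ P := by
      refine Ideal.span_le.mpr ?_ hv
      rintro _ ⟨i, rfl⟩
      simpa using hgen i.succ
    have hsb : s * b 0 ∈ P := (hPp.radical_le_iff.mpr hIP) ((hK s).mp hs)
    by_cases ha : a ∈ P
    · exact ha
    have hb : b 0 ∈ P := by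
      rcases hPp.mem_or_mem hsb with hs | hb
      · exact (P.add_mem_iff_left (P.mul_mem_left a hs)).mp h0
      · exact hb
    have hsP : s ∈ P :=
      (hPp.mem_or_mem ((P.add_mem_iff_right hb).mp h0)).resolve_left ha
    have hwP : w ∈ P := by
      refine (sup_le hIP ?_ : I ⊔ Ideal.span {b 0} ≤ P) hw
      rwa [Ideal.span_singleton_le_iff_mem]
    exact hPp.mem_of_pow_mem k (huv ▸ P.add_mem (P.add_mem hwP hsP) hvP)

/-- In a local ring whose maximal ideal has height `h`, every finite subset of the maximal ideal
is contained in the radical of an ideal generated by `h` elements. -/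
lemma IsLocalRing.exists_fin_subset_radical_span [IsLocalRing A] {h : ℕ}
    (hh : Order.height (IsLocalRing.closedPoint A) = h) (s : Finset A)
    (hs : ∀ a ∈ s, a ∈ IsLocalRing.maximalIdeal A) :
    ∃ y : Fin h → A, (∀ i, y i ∈ IsLocalRing.maximalIdeal A) ∧
      ∀ a ∈ s, a ∈ (Ideal.span (Set.range y)).radical := by
  classical
  induction s using Finset.induction_on with
  | empty => exact ⟨0, by simp, by simp⟩
  | insert a s _ ih =>
    obtain ⟨y, hy, hsy⟩ := ih fun b hb => hs b (Finset.mem_insert_of_mem hb)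
    have ha := hs a (Finset.mem_insert_self a s)
    obtain ⟨c, hc⟩ := exists_mem_radical_sup_span_add_mul a h ⊥ y fun l _ hl => by
      have hlt : l.last < IsLocalRing.closedPoint A :=
        lt_of_le_of_ne (IsLocalRing.le_maximalIdeal l.last.2.ne_top) fun h => hl (h ▸ ha)
      have := Order.length_le_height_last (p := l.snoc _ hlt)
      rw [RelSeries.last_snoc, hh, RelSeries.snoc_length] at this
      exact_mod_cast this
    rw [bot_sup_eq] at hc
    refine ⟨fun i => y i + a * c i, fun i => add_mem (hy i) (Ideal.mul_mem_right _ _ ha), ?_⟩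
    have hspan : Ideal.span (Set.range y) ≤
        (Ideal.span (Set.range fun i => y i + a * c i)).radical := by
      rw [Ideal.span_le]
      rintro _ ⟨i, rfl⟩
      refine (Ideal.add_mem_iff_left _ (Ideal.mul_mem_right (c i) _ hc)).mp ?_
      exact Ideal.le_radical (Ideal.subset_span ⟨i, rfl⟩)
    intro b hb
    rcases Finset.mem_insert.mp hb with rfl | hb
    · exact hc
    · exact (Ideal.radical_le_radical_iff.mpr hspan) (hsy b hb)

lemma not_koszulVanishing_of_mem_maximalIdeal [IsLocalRing A] {n : ℕ} (y : Fin n → A)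
    (hy : ∀ i, y i ∈ IsLocalRing.maximalIdeal A) : ¬ KoszulVanishing A y Finset.univ n := by
  intro h
  obtain ⟨u, hu⟩ := h (fun _ => 1) fun t _ hc => by
    have := Finset.card_le_univ t
    rw [Fintype.card_fin] at this
    omega
  have h1 := hu Finset.univ subset_rfl (by simp)
  refine (Ideal.ne_top_iff_one _).mp (IsLocalRing.maximalIdeal.isMaximal A).ne_top ?_
  rw [← h1]
  exact sum_mem fun j _ => Ideal.mul_mem_right _ _ (Ideal.mul_mem_left _ _ (hy j))

/-- The Koszul grade of an ideal on the ring is bounded by its height. -/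
lemma kgr_le_idealHeight (𝔞 : Ideal A) : kgr A 𝔞 A ≤ idealHeight A 𝔞 := by
  refine le_iInf₂ fun p hp => ?_
  by_contra! hlt
  obtain ⟨h, hh⟩ := ENat.ne_top_iff_exists.mp hlt.ne_top
  rw [← hh] at hlt
  obtain ⟨n, x, hx, hv⟩ := (natCast_le_kgr_iff 𝔞 A (h + 1)).mp
    (by exact_mod_cast Order.add_one_le_of_lt hlt)
  let R := Localization.AtPrime p.asIdeal
  have hR : Order.height (IsLocalRing.closedPoint R) = h := by
    have hp := IsLocalization.AtPrime.ringKrullDim_eq_height p.asIdeal R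
    rw [← IsLocalRing.maximalIdeal_height_eq_ringKrullDim, WithBot.coe_inj] at hp
    rw [hh, ← p.height_eq_orderHeight, ← hp]
    exact (IsLocalRing.closedPoint R).height_eq_orderHeight.symm
  classical
  obtain ⟨y, hy, hxy⟩ := IsLocalRing.exists_fin_subset_radical_span hR
    (Finset.univ.image (algebraMap A R ∘ x)) fun a ha => by
      obtain ⟨j, -, rfl⟩ := Finset.mem_image.mp ha
      exact (IsLocalization.AtPrime.to_map_mem_maximal_iff R p.asIdeal (x j)).mpr (hp (hx j))
  refine not_koszulVanishing_of_mem_maximalIdeal y hy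
    (KoszulVanishing.mono (x := algebraMap A R ∘ x) (r := h + 1) (fun j => ?_)
      (fun k hk => (hv k hk).localization p.asIdeal.primeCompl R) h h.lt_succ_self)
  exact hxy _ (Finset.mem_image_of_mem _ (Finset.mem_univ j))

end KoszulGrade

section Amalgamation

variable {A B : Type*} [CommRing A] [CommRing B] (f : A →+* B) (J : Ideal B)

/-- The projection `A ⋈^f J → A`. -/
def amalgFst : amalgamation f J →+* A :=
  (RingHom.fst A B).comp (amalgamation f J).subtype

variable {f J}

lemma isNilpotent_sub_amalgIota (hJ : J ≤ nilradical B) (z : amalgamation f J) :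
    IsNilpotent (z - amalgIota f J (amalgFst f J z)) := by
  have hz : IsNilpotent ((z : A × B).2 - f (z : A × B).1) := hJ z.2
  obtain ⟨n, hn⟩ := hz
  refine ⟨n + 1, Subtype.ext (Prod.ext ?_ ?_)⟩
  · show ((z : A × B).1 - (z : A × B).1) ^ (n + 1) = 0
    rw [sub_self, zero_pow n.succ_ne_zero]
  · show ((z : A × B).2 - f (z : A × B).1) ^ (n + 1) = 0
    rw [pow_succ, hn, zero_mul]

lemma amalgIota_amalgFst_mem_iff (hJ : J ≤ nilradical B) {P : Ideal (amalgamation f J)}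
    (hP : P.IsPrime) (z : amalgamation f J) : amalgIota f J (amalgFst f J z) ∈ P ↔ z ∈ P := by
  obtain ⟨n, hn⟩ := isNilpotent_sub_amalgIota hJ z
  have h : z - amalgIota f J (amalgFst f J z) ∈ P := hP.mem_of_pow_mem n (hn ▸ P.zero_mem)
  rw [← P.add_mem_iff_right h, sub_add_cancel]

/-- If `J` is nil, then `A ⋈^f J` and `A` have the same spectrum. -/
def primeSpectrumAmalgOrderIso (hJ : J ≤ nilradical B) :
    PrimeSpectrum A ≃o PrimeSpectrum (amalgamation f J) where
  toFun := PrimeSpectrum.comap (amalgFst f J)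
  invFun := PrimeSpectrum.comap (amalgIota f J)
  left_inv _ := rfl
  right_inv Q := PrimeSpectrum.ext (Ideal.ext (amalgIota_amalgFst_mem_iff hJ Q.2))
  map_rel_iff' {P _} :=
    ⟨fun h a ha => h (show amalgIota f J a ∈ P.asIdeal.comap (amalgFst f J) from ha),
      fun h _ hz => h hz⟩

lemma idealHeight_amalgamation (hJ : J ≤ nilradical B) (𝔟 : Ideal (amalgamation f J)) :
    idealHeight _ 𝔟 = idealHeight A (𝔟.map (amalgFst f J)) := by
  rw [idealHeight, idealHeight, ← (primeSpectrumAmalgOrderIso hJ).toEquiv.iInf_comp]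
  refine iInf_congr fun P => iInf_congr_Prop Ideal.map_le_iff_le_comap.symm fun _ => ?_
  exact Order.height_orderIso (primeSpectrumAmalgOrderIso hJ) P

lemma radical_amalgamation (hJ : J ≤ nilradical B) (𝔟 : Ideal (amalgamation f J)) :
    𝔟.radical = ((𝔟.map (amalgFst f J)).map (amalgIota f J)).radical := by
  have key (P : Ideal (amalgamation f J)) (hP : P.IsPrime) :
      (𝔟.map (amalgFst f J)).map (amalgIota f J) ≤ P ↔ 𝔟 ≤ P := by
    rw [Ideal.map_le_iff_le_comap, Ideal.map_le_iff_le_comap]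
    exact forall₂_congr fun z _ => amalgIota_amalgFst_mem_iff hJ hP z
  rw [Ideal.radical_eq_sInf, Ideal.radical_eq_sInf]
  congr 1
  ext P
  exact and_congr_left fun hP => (key P hP).symm

lemma kgr_amalgamation (hJ : J ≤ nilradical B) (𝔟 : Ideal (amalgamation f J)) :
    kgr _ 𝔟 (amalgamation f J) =
      min (kgr A (𝔟.map (amalgFst f J)) A) (kgrIdeal f J (𝔟.map (amalgFst f J))) := by
  let _ : Module A J := Module.compHom J f
  let e : (A × J) ≃+ amalgamation f J :=
    { toFun p := ⟨(p.1, f p.1 + p.2), show f p.1 + p.2 - f p.1 ∈ J by simp⟩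
      invFun z := ((z : A × B).1, ⟨(z : A × B).2 - f (z : A × B).1, z.2⟩)
      left_inv p := by ext <;> simp
      right_inv z := by ext <;> simp
      map_add' p q := Subtype.ext (Prod.ext rfl (by
        show f (p.1 + q.1) + ((p.2 : B) + q.2) = (f p.1 + p.2) + (f q.1 + q.2)
        rw [map_add]; ring)) }
  have he (a : A) (p : A × J) : e (a • p) = amalgIota f J a • e p := by
    refine Subtype.ext (Prod.ext rfl ?_)
    show f (a * p.1) + f a * (p.2 : B) = f a * (f p.1 + p.2)
    rw [map_mul]; ring
  rw [kgr_eq_of_radical_eq_map (amalgIota f J) e he (radical_amalgamation hJ 𝔟), kgr_prod]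
  rfl

lemma map_amalgFst_map_amalgIota (𝔞 : Ideal A) :
    (𝔞.map (amalgIota f J)).map (amalgFst f J) = 𝔞 := by
  rw [Ideal.map_map]
  exact Ideal.map_id 𝔞

end Amalgamation

/-- Assume `J ⊆ Nil(B)`. Then `A⋈^f J` is Cohen-Macaulay in the sense
of ideals iff `A` is Cohen-Macaulay in the sense of ideals and `kgr_A(𝔞, J) ≥ height 𝔞`
for every ideal `𝔞` of `A`. -/
theorem isCMIdeals_amalgamation_iff_of_nil {A B : Type*} [CommRing A] [CommRing B]
    (f : A →+* B) (J : Ideal B) (hJ : J ≤ nilradical B) :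
    IsCMIdeals ↥(amalgamation f J) ↔
      IsCMIdeals A ∧ ∀ 𝔞 : Ideal A, idealHeight A 𝔞 ≤ kgrIdeal f J 𝔞 := by
  constructor
  · intro h
    have key (𝔞 : Ideal A) : idealHeight A 𝔞 = min (kgr A 𝔞 A) (kgrIdeal f J 𝔞) := by
      have := h (𝔞.map (amalgIota f J))
      rwa [idealHeight_amalgamation hJ, kgr_amalgamation hJ, map_amalgFst_map_amalgIota] at this
    exact ⟨fun 𝔞 => le_antisymm ((key 𝔞).trans_le (min_le_left _ _)) (kgr_le_idealHeight 𝔞),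
      fun 𝔞 => (key 𝔞).trans_le (min_le_right _ _)⟩
  · rintro ⟨hA, hle⟩ 𝔟
    rw [idealHeight_amalgamation hJ, kgr_amalgamation hJ, ← hA, min_eq_left (hle _)]
end

section
/- Let A be a Noetherian ring and M a finitely generated A-module. Then height 𝔞 ≤ grade_A(𝔞, M) for every ideal 𝔞 of A if and only if M_𝔭 is a maximal Cohen-Macaulay A_𝔭-module for every prime ideal 𝔭 ∈ Supp_A(M). -/
open scoped Pointwise

namespace Koszul

variable {A : Type*} [CommRing A] {M N : Type*} [AddCommGroup M] [Module A M]
  [AddCommGroup N] [Module A N] {n : ℕ}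

/-- The Koszul sign of removing `j` from `t`. -/
def sign (A : Type*) [CommRing A] (j : Fin n) (t : Finset (Fin n)) : A :=
  (-1) ^ (t.filter (fun k => k < j)).card

lemma sign_mul_self (j : Fin n) (t : Finset (Fin n)) : sign A j t * sign A j t = 1 := by
  rw [sign, ← mul_pow]; simp

lemma sign_erase_of_le {j l : Fin n} (h : j ≤ l) (t : Finset (Fin n)) :
    sign A j (t.erase l) = sign A j t := by
  unfold sign
  congr 2
  ext k
  simp only [Finset.mem_filter, Finset.mem_erase]
  grind

lemma sign_erase_of_lt {j l : Fin n} (h : j < l) {t : Finset (Fin n)} (hj : j ∈ t) :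
    sign A l (t.erase j) = - sign A l t := by
  have h1 : (t.erase j).filter (fun k => k < l) = (t.filter (fun k => k < l)).erase j := by
    ext k
    simp only [Finset.mem_filter, Finset.mem_erase]
    tauto
  have h2 : j ∈ t.filter (fun k => k < l) := by simp [hj, h]
  unfold sign
  rw [h1, ← Finset.card_erase_add_one h2, pow_succ]
  simp

lemma sign_mul_sign_erase {j l : Fin n} (h : j ≠ l) {t : Finset (Fin n)}
    (hj : j ∈ t) (hl : l ∈ t) :
    sign A j t * sign A l (t.erase j) = -(sign A l t * sign A j (t.erase l)) := by
  rcases lt_or_gt_of_ne h with h | h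
  · rw [sign_erase_of_lt h hj, sign_erase_of_le h.le]; ring
  · rw [sign_erase_of_lt h hl, sign_erase_of_le h.le]; ring

/-- The Koszul differential on the total (ungraded) Koszul module. -/
def diff (M : Type*) [AddCommGroup M] [Module A M] (x : Fin n → A) :
    (Finset (Fin n) → M) →ₗ[A] (Finset (Fin n) → M) where
  toFun g t := ∑ j ∈ t, (sign A j t * x j) • g (t.erase j)
  map_add' g h := funext fun t => by simp [smul_add, Finset.sum_add_distrib]
  map_smul' a g := funext fun t => by
    simp only [Pi.smul_apply, RingHom.id_apply, Finset.smul_sum]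
    exact Finset.sum_congr rfl fun j _ => smul_comm _ _ _

lemma diff_apply (x : Fin n → A) (g : Finset (Fin n) → M) (t : Finset (Fin n)) :
    diff M x g t = ∑ j ∈ t, (sign A j t * x j) • g (t.erase j) := rfl

lemma diff_comp (x : Fin n → A) (f : M →ₗ[A] N) (g : Finset (Fin n) → M) :
    diff N x (fun s => f (g s)) = fun s => f (diff M x g s) := by
  funext t
  simp [diff_apply]

lemma diff_diff (x : Fin n → A) (g : Finset (Fin n) → M) : diff M x (diff M x g) = 0 := by
  funext t
  simp only [diff_apply, Finset.smul_sum, Pi.zero_apply]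
  rw [Finset.sum_sigma']
  refine Finset.sum_involution (fun p _ => ⟨p.2, p.1⟩) ?_ ?_ ?_ ?_
  · rintro ⟨j, l⟩ h
    simp only [Finset.mem_sigma, Finset.mem_erase] at h
    rw [smul_smul, smul_smul, Finset.erase_right_comm, ← add_smul]
    have := sign_mul_sign_erase (A := A) (Ne.symm h.2.1) h.1 h.2.2
    convert zero_smul A _
    linear_combination (x j * x l) * this
  · rintro ⟨j, l⟩ h _ h'
    simp only [Finset.mem_sigma, Finset.mem_erase] at h
    simp only [Sigma.mk.injEq] at h'
    exact h.2.1 h'.1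
  · rintro ⟨j, l⟩ h
    simp only [Finset.mem_sigma, Finset.mem_erase] at h ⊢
    exact ⟨h.2.2, Ne.symm h.2.1, h.1⟩
  · rintro ⟨j, l⟩ h
    rfl

/-- Contraction with the `j`-th basis vector, a homotopy for multiplication by `x j`. -/
def contract (j : Fin n) (g : Finset (Fin n) → M) (s : Finset (Fin n)) : M :=
  if j ∈ s then 0 else (sign A j s) • g (insert j s)

lemma diff_contract_add (x : Fin n → A) (j : Fin n) (g : Finset (Fin n) → M) :
    diff M x (contract (A := A) j g) + contract (A := A) j (diff M x g) = x j • g := by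
  funext t
  by_cases hj : j ∈ t
  · simp only [Pi.add_apply, Pi.smul_apply, contract, hj, if_true, add_zero, diff_apply]
    rw [Finset.sum_eq_single_of_mem j hj]
    · simp only [Finset.notMem_erase, if_false, Finset.insert_erase hj, smul_smul]
      rw [sign_erase_of_le le_rfl, mul_right_comm, sign_mul_self, one_mul]
    · intro l _ hl
      simp [hj, Ne.symm hl]
  · simp only [Pi.add_apply, Pi.smul_apply, contract, hj, if_false, diff_apply]
    rw [Finset.sum_insert hj, smul_add, ← add_assoc, add_right_comm, Finset.erase_insert hj,
      Finset.smul_sum, ← Finset.sum_add_distrib, smul_smul, Finset.sum_eq_zero, zero_add]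
    · have h := sign_erase_of_le (A := A) (le_refl j) (insert j t)
      rw [Finset.erase_insert hj] at h
      rw [h, ← mul_assoc, sign_mul_self, one_mul]
    · intro l hl
      have hlj : l ≠ j := fun h => hj (h ▸ hl)
      have h1 : j ∉ t.erase l := fun h => hj (Finset.mem_of_mem_erase h)
      rw [if_neg h1, smul_smul, smul_smul, Finset.erase_insert_of_ne (Ne.symm hlj), ← add_smul]
      convert zero_smul A _
      rcases lt_or_gt_of_ne hlj with hlt | hlt
      · have a := sign_erase_of_le (A := A) hlt.le (insert j t)
        have b := sign_erase_of_lt (A := A) hlt hl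
        rw [Finset.erase_insert hj] at a
        rw [a, b]; ring
      · have a := sign_erase_of_lt (A := A) hlt (Finset.mem_insert_self j t)
        have b := sign_erase_of_le (A := A) hlt.le t
        rw [Finset.erase_insert hj] at a
        rw [a, b]; ring

/-- Vanishing of the `i`-th Koszul cohomology, phrased on the total Koszul module. -/
def Vanishes (M : Type*) [AddCommGroup M] [Module A M] (x : Fin n → A) (i : ℕ) : Prop :=
  ∀ g : Finset (Fin n) → M, (∀ s, s.card ≠ i → g s = 0) → diff M x g = 0 →
    ∃ w : Finset (Fin n) → M, (∀ s, s.card + 1 ≠ i → w s = 0) ∧ diff M x w = g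

/-- Extension by zero of a homogeneous Koszul cochain. -/
def extend {i : ℕ} (g : {s : Finset (Fin n) // s.card = i} → M) (s : Finset (Fin n)) : M :=
  if h : s.card = i then g ⟨s, h⟩ else 0

lemma extend_of_card_ne {i : ℕ} (g : {s : Finset (Fin n) // s.card = i} → M)
    (s : Finset (Fin n)) (h : s.card ≠ i) : extend g s = 0 := dif_neg h

lemma extend_restrict {i : ℕ} (g : Finset (Fin n) → M) (hg : ∀ s, s.card ≠ i → g s = 0) :
    extend (fun s : {s : Finset (Fin n) // s.card = i} => g s.1) = g := by
  funext s
  by_cases h : s.card = i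
  · simp [extend, h]
  · simp [extend, h, hg s h]

lemma diff_of_card_ne (x : Fin n → A) {i : ℕ} {w : Finset (Fin n) → M}
    (hw : ∀ s, s.card + 1 ≠ i → w s = 0) (t : Finset (Fin n)) (ht : t.card ≠ i) :
    diff M x w t = 0 := by
  rw [diff_apply]
  refine Finset.sum_eq_zero fun j hj => ?_
  rw [hw, smul_zero]
  rwa [Finset.card_erase_add_one hj]

lemma koszulMap_apply (x : Fin n → A) (i : ℕ) (g : {s : Finset (Fin n) // s.card = i} → M)
    (t : {s : Finset (Fin n) // s.card = i + 1}) :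
    koszulMap A M x i g t = diff M x (extend g) t.1 := by
  rw [diff_apply, ← Finset.sum_attach]
  refine Finset.sum_congr rfl fun j _ => ?_
  have h : (t.1.erase j.1).card = i := by
    rw [Finset.card_erase_of_mem j.2, t.2]; omega
  rw [extend, dif_pos h]
  rfl

lemma koszulMap_eq_zero_iff (x : Fin n → A) (i : ℕ)
    (g : {s : Finset (Fin n) // s.card = i} → M) :
    koszulMap A M x i g = 0 ↔ diff M x (extend g) = 0 := by
  constructor
  · intro h
    funext t
    by_cases ht : t.card = i + 1
    · rw [← koszulMap_apply x i g ⟨t, ht⟩, h]; rfl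
    · exact diff_of_card_ne x (fun s hs => extend_of_card_ne g s (by omega)) t ht
  · intro h
    funext t
    rw [koszulMap_apply, h]; rfl

lemma koszulCohomologyNeZero_iff (x : Fin n → A) (i : ℕ) :
    koszulCohomologyNeZero A M x i ↔ ¬ Vanishes M x i := by
  cases i with
  | zero =>
    rw [koszulCohomologyNeZero, Ne, not_iff_not, LinearMap.ker_eq_bot']
    constructor
    · intro h g hg hd
      refine ⟨0, fun _ _ => rfl, ?_⟩
      rw [map_zero, ← extend_restrict g hg]
      have := h _ ((koszulMap_eq_zero_iff x 0 _).2 (by rwa [extend_restrict g hg]))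
      rw [this]
      funext s
      simp [extend]
    · intro h g hg
      obtain ⟨w, hw, hd⟩ := h (extend g) (extend_of_card_ne g) ((koszulMap_eq_zero_iff x 0 g).1 hg)
      have : w = 0 := funext fun s => hw s (by omega)
      rw [this, map_zero] at hd
      funext s
      have := congrFun hd s.1
      rw [extend, dif_pos s.2] at this
      exact this.symm
  | succ i =>
    rw [koszulCohomologyNeZero, not_iff_not]
    constructor
    · intro h g hg hd
      obtain ⟨w, hw⟩ := h (x := fun s => g s.1) (by
        rw [LinearMap.mem_ker, koszulMap_eq_zero_iff, extend_restrict g hg, hd])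
      have hw' : ∀ s : Finset (Fin n), s.card + 1 ≠ i + 1 → extend w s = 0 :=
        fun s hs => extend_of_card_ne w s (by omega)
      refine ⟨extend w, hw', funext fun s => ?_⟩
      by_cases hs : s.card = i + 1
      · rw [← koszulMap_apply x i w ⟨s, hs⟩, hw]
      · rw [diff_of_card_ne x hw' s hs, hg s hs]
    · intro h g hg
      obtain ⟨w, hw, hd⟩ := h (extend g) (extend_of_card_ne g)
        ((koszulMap_eq_zero_iff x _ g).1 hg)
      refine ⟨fun s => w s.1, funext fun t => ?_⟩
      rw [koszulMap_apply, extend_restrict w (fun s hs => hw s (by omega)), hd, extend,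
        dif_pos t.2]

lemma le_kgrSeq_iff (x : Fin n → A) (k : ℕ) :
    (k : ℕ∞) ≤ kgrSeq A M x ↔ ∀ i < k, Vanishes M x i := by
  rw [kgrSeq, le_sInf_iff]
  constructor
  · intro h i hi
    by_contra hv
    have := h i ⟨i, rfl, (koszulCohomologyNeZero_iff x i).2 hv⟩
    exact absurd (by exact_mod_cast this) (not_le.2 hi)
  · rintro h _ ⟨i, rfl, hi⟩
    rw [koszulCohomologyNeZero_iff] at hi
    by_contra hk
    exact hi (h i (by exact_mod_cast not_le.1 hk))

/-- The ideal generated by `x` annihilates the Koszul cohomology. -/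
lemma exists_diff_eq_smul (x : Fin n → A) {y : A} (hy : y ∈ Ideal.span (Set.range x)) {i : ℕ}
    {g : Finset (Fin n) → M} (hg : ∀ s, s.card ≠ i → g s = 0) (hd : diff M x g = 0) :
    ∃ w : Finset (Fin n) → M, (∀ s, s.card + 1 ≠ i → w s = 0) ∧ diff M x w = y • g := by
  induction hy using Submodule.span_induction with
  | mem y h =>
    obtain ⟨j, rfl⟩ := h
    refine ⟨contract (A := A) j g, fun s hs => ?_, ?_⟩
    · unfold contract
      split_ifs with hj
      · rfl
      · rw [hg, smul_zero]
        rwa [Finset.card_insert_of_notMem hj]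
    · rw [← diff_contract_add, hd]
      simp only [left_eq_add]
      funext s
      simp [contract]
  | zero => exact ⟨0, fun _ _ => rfl, by simp⟩
  | add a b _ _ ha hb =>
    obtain ⟨w, hw, h⟩ := ha
    obtain ⟨w', hw', h'⟩ := hb
    refine ⟨w + w', fun s hs => ?_, by rw [map_add, h, h', add_smul]⟩
    simp [hw s hs, hw' s hs]
  | smul a b _ hb =>
    obtain ⟨w, hw, h⟩ := hb
    refine ⟨a • w, fun s hs => ?_, by rw [map_smul, h, smul_assoc]⟩
    simp [hw s hs]

lemma exists_lift (y : A) {p : Finset (Fin n) → Prop} (v : Finset (Fin n) → QuotSMulTop y M)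
    (hv : ∀ s, p s → v s = 0) : ∃ v' : Finset (Fin n) → M,
      (∀ s, p s → v' s = 0) ∧ (fun s => (y • (⊤ : Submodule A M)).mkQ (v' s)) = v := by
  classical
  choose f hf using Submodule.mkQ_surjective (y • (⊤ : Submodule A M))
  refine ⟨fun s => if p s then 0 else f (v s), fun s hs => if_pos hs, funext fun s => ?_⟩
  dsimp only
  split_ifs with h
  · rw [map_zero, hv s h]
  · exact hf _

lemma exists_smul_eq {y : A} {p : Finset (Fin n) → Prop} {g : Finset (Fin n) → M}
    (hg : ∀ s, p s → g s = 0) (h : (fun s => (y • (⊤ : Submodule A M)).mkQ (g s)) = 0) :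
    ∃ u : Finset (Fin n) → M, (∀ s, p s → u s = 0) ∧ y • u = g := by
  classical
  have h' : ∀ s, ∃ m : M, y • m = g s := fun s => by
    have := congrFun h s
    simp only [Pi.zero_apply, Submodule.mkQ_apply, Submodule.Quotient.mk_eq_zero] at this
    obtain ⟨m, -, hm⟩ := (Submodule.mem_smul_pointwise_iff_exists _ _ _).1 this
    exact ⟨m, hm⟩
  choose f hf using h'
  refine ⟨fun s => if p s then 0 else f s, fun s hs => if_pos hs, funext fun s => ?_⟩
  by_cases hs : p s
  · simp [hs, hg s hs]
  · simp [hs, hf]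

lemma smul_right_injective {y : A} (hy : IsSMulRegular M y) {g h : Finset (Fin n) → M}
    (e : y • g = y • h) : g = h :=
  funext fun s => hy (congrFun e s)

lemma vanishes_zero_of_regular {x : Fin n → A} {y : A} (hyx : y ∈ Ideal.span (Set.range x))
    (hy : IsSMulRegular M y) : Vanishes M x 0 := by
  intro g hg hd
  obtain ⟨w, hw, h⟩ := exists_diff_eq_smul x hyx hg hd
  have : w = 0 := funext fun s => hw s (by omega)
  rw [this, map_zero, ← smul_zero y] at h
  exact ⟨0, fun _ _ => rfl, by rw [map_zero, smul_right_injective hy h]⟩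

lemma vanishes_succ_of_quotSMulTop {x : Fin n → A} {y : A}
    (hyx : y ∈ Ideal.span (Set.range x)) (hy : IsSMulRegular M y) {i : ℕ}
    (hv : Vanishes (QuotSMulTop y M) x i) : Vanishes M x (i + 1) := by
  intro g hg hd
  obtain ⟨w, hw, h⟩ := exists_diff_eq_smul x hyx hg hd
  obtain ⟨v, hv, hv'⟩ := hv (fun s => (y • (⊤ : Submodule A M)).mkQ (w s))
    (fun s hs => by simp [hw s (by omega)]) (by
      rw [diff_comp, h]
      funext s
      simp only [Pi.smul_apply, Pi.zero_apply, Submodule.mkQ_apply, Submodule.Quotient.mk_eq_zero]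
      exact Submodule.smul_mem_pointwise_smul _ _ _ trivial)
  obtain ⟨v, hv₁, rfl⟩ := exists_lift y v hv
  rw [diff_comp] at hv'
  obtain ⟨u, hu, hu'⟩ := exists_smul_eq (y := y) (p := fun s => s.card + 1 ≠ i + 1)
    (g := w - diff M x v) (fun s hs => by
      rw [Pi.sub_apply, hw s hs, diff_of_card_ne x hv₁ s (by omega), sub_zero])
    (by
      funext s
      simp only [Pi.sub_apply, map_sub, Pi.zero_apply]
      exact sub_eq_zero.2 (congrFun hv' s).symm)
  refine ⟨u, hu, smul_right_injective hy ?_⟩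
  rw [← map_smul, hu', map_sub, diff_diff, sub_zero, h]

lemma vanishes_quotSMulTop {x : Fin n → A} {y : A} (hy : IsSMulRegular M y) {i : ℕ}
    (hv : Vanishes M x i) (hv' : Vanishes M x (i + 1)) :
    Vanishes (QuotSMulTop y M) x i := by
  intro g hg hd
  obtain ⟨z, hz, rfl⟩ := exists_lift y g hg
  rw [diff_comp] at hd
  obtain ⟨u, hu, hu'⟩ := exists_smul_eq (y := y) (p := fun s => s.card ≠ i + 1)
    (g := diff M x z) (fun s hs => diff_of_card_ne x (fun s hs => hz s (by omega)) s hs) hd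
  obtain ⟨v, hv1, rfl⟩ := hv' u hu (smul_right_injective hy (by
    rw [← map_smul, hu', diff_diff, smul_zero]))
  obtain ⟨t, ht, ht'⟩ := hv (z - y • v)
    (fun s hs => by simp [hz s hs, hv1 s (by omega)])
    (by rw [map_sub, map_smul, hu', sub_self])
  refine ⟨fun s => (y • (⊤ : Submodule A M)).mkQ (t s), fun s hs => by simp [ht s hs], ?_⟩
  rw [diff_comp, ht']
  funext s
  simp only [Pi.sub_apply, Pi.smul_apply, map_sub, sub_eq_self, Submodule.mkQ_apply,
    Submodule.Quotient.mk_eq_zero]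
  exact Submodule.smul_mem_pointwise_smul _ _ _ trivial

lemma Vanishes.eq_zero {x : Fin n → A} (h : Vanishes M x 0) {m : M} (hm : ∀ j, x j • m = 0) :
    m = 0 := by
  obtain ⟨w, hw, hd⟩ := h (fun s => if s.card = 0 then m else 0) (fun s hs => if_neg hs) (by
    funext t
    rw [diff_apply]
    refine Finset.sum_eq_zero fun j _ => ?_
    rw [mul_smul]
    split_ifs <;> simp [hm])
  have : w = 0 := funext fun s => hw s (by omega)
  rw [this, map_zero] at hd
  simpa using (congrFun hd ∅).symm

end Koszul

open RingTheory.Sequence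

section Grade

variable {A : Type*} [CommRing A] {M : Type*} [AddCommGroup M] [Module A M] {n : ℕ}

lemma le_kgrSeq_quotSMulTop {x : Fin n → A} {y : A} (hy : IsSMulRegular M y) {k : ℕ}
    (h : ((k + 1 : ℕ) : ℕ∞) ≤ kgrSeq A M x) : (k : ℕ∞) ≤ kgrSeq A (QuotSMulTop y M) x := by
  rw [Koszul.le_kgrSeq_iff] at h ⊢
  exact fun i hi => Koszul.vanishes_quotSMulTop hy (h i (by omega)) (h (i + 1) (by omega))

lemma length_le_kgrSeq {x : Fin n → A} {rs : List A}
    (hrs : ∀ r ∈ rs, r ∈ Ideal.span (Set.range x)) (h : IsWeaklyRegular M rs) :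
    (rs.length : ℕ∞) ≤ kgrSeq A M x := by
  induction rs generalizing M with
  | nil => simp
  | cons r rs ih =>
    rw [isWeaklyRegular_cons_iff] at h
    have ih := ih (fun s hs => hrs s (List.mem_cons_of_mem _ hs)) h.2
    rw [Koszul.le_kgrSeq_iff] at ih ⊢
    intro i hi
    cases i with
    | zero => exact Koszul.vanishes_zero_of_regular (hrs r List.mem_cons_self) h.1
    | succ i =>
      exact Koszul.vanishes_succ_of_quotSMulTop (hrs r List.mem_cons_self) h.1
        (ih i (by simpa using hi))

lemma length_le_kgr {𝔞 : Ideal A} {rs : List A}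
    (hrs : ∀ r ∈ rs, r ∈ 𝔞) (h : IsWeaklyRegular M rs) : (rs.length : ℕ∞) ≤ kgr A 𝔞 M := by
  have hx : Ideal.span (Set.range rs.get) ≤ 𝔞 := by
    rw [Ideal.span_le]
    rintro _ ⟨j, rfl⟩
    exact hrs _ (List.get_mem _ _)
  refine (length_le_kgrSeq (x := rs.get) (fun r hr => Ideal.subset_span ?_) h).trans ?_
  · rwa [Set.range_list_get]
  · exact le_iSup_of_le rs.length (le_iSup_of_le rs.get
      (le_iSup_of_le (fun j => hrs _ (List.get_mem _ _)) le_rfl))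

lemma exists_le_kgrSeq {𝔞 : Ideal A} {k : ℕ} (h : (k : ℕ∞) ≤ kgr A 𝔞 M) :
    ∃ (n : ℕ) (x : Fin n → A), (∀ j, x j ∈ 𝔞) ∧ (k : ℕ∞) ≤ kgrSeq A M x := by
  cases k with
  | zero => exact ⟨0, Fin.elim0, fun j => j.elim0, by simp⟩
  | succ k =>
    have h : (k : ℕ∞) < kgr A 𝔞 M := lt_of_lt_of_le (by exact_mod_cast k.lt_succ_self) h
    simp only [kgr, lt_iSup_iff] at h
    obtain ⟨n, x, hx, h⟩ := h
    exact ⟨n, x, hx, by simpa using Order.add_one_le_of_lt h⟩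

/-- A socle element modulo a weakly regular sequence bounds the Koszul grade. -/
lemma kgrSeq_lt_of_smul_mem {x : Fin n → A} {rs : List A} (h : IsWeaklyRegular M rs) {m : M}
    (hm : m ∉ (Ideal.ofList rs • ⊤ : Submodule A M))
    (hxm : ∀ j, x j • m ∈ (Ideal.ofList rs • ⊤ : Submodule A M)) :
    ¬ ((rs.length + 1 : ℕ) : ℕ∞) ≤ kgrSeq A M x := by
  induction rs generalizing M with
  | nil =>
    intro hk
    rw [Koszul.le_kgrSeq_iff] at hk
    simp only [Ideal.ofList_nil, Submodule.bot_smul, Submodule.mem_bot] at hm hxm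
    exact hm ((hk 0 (by simp)).eq_zero hxm)
  | cons r rs ih =>
    rw [isWeaklyRegular_cons_iff] at h
    have key : ∀ z : M, z ∈ (Ideal.ofList (r :: rs) • ⊤ : Submodule A M) ↔
        (r • (⊤ : Submodule A M)).mkQ z ∈
          (Ideal.ofList rs • ⊤ : Submodule A (QuotSMulTop r M)) := fun z => by
      rw [← Submodule.Quotient.mk_eq_zero, ← Submodule.Quotient.mk_eq_zero,
        ← (Submodule.quotOfListConsSMulTopEquivQuotSMulTopInner M r rs).map_eq_zero_iff]
      rfl
    intro hk
    refine ih h.2 (m := (r • (⊤ : Submodule A M)).mkQ m) (by rwa [← key])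
      (fun j => ?_) (le_kgrSeq_quotSMulTop h.1 hk)
    rw [← map_smul, ← key]
    exact hxm j

lemma kgr_lt_of_smul_mem {𝔞 : Ideal A} {rs : List A} (h : IsWeaklyRegular M rs) {m : M}
    (hm : m ∉ (Ideal.ofList rs • ⊤ : Submodule A M))
    (hxm : ∀ y ∈ 𝔞, y • m ∈ (Ideal.ofList rs • ⊤ : Submodule A M)) :
    ¬ ((rs.length + 1 : ℕ) : ℕ∞) ≤ kgr A 𝔞 M := fun hk => by
  obtain ⟨n, x, hx, hk⟩ := exists_le_kgrSeq hk
  exact kgrSeq_lt_of_smul_mem h hm (fun j => hxm _ (hx j)) hk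

variable [IsNoetherianRing A] [Module.Finite A M]

/-- An ideal consisting of zero divisors is contained in an associated prime. -/
lemma exists_isAssociatedPrime_of_forall_not_isSMulRegular {𝔞 : Ideal A}
    (h : ∀ y ∈ 𝔞, ¬ IsSMulRegular M y) : ∃ q : Ideal A, IsAssociatedPrime q M ∧ 𝔞 ≤ q := by
  have hs : (𝔞 : Set A) ⊆ ⋃ p ∈ associatedPrimes A M, (p : Set A) := by
    rw [biUnion_associatedPrimes_eq_zero_divisors]
    intro y hy
    have := h y hy
    rw [isSMulRegular_iff_right_eq_zero_of_smul] at this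
    push Not at this
    obtain ⟨m, hm, hm'⟩ := this
    exact ⟨m, hm', hm⟩
  exact (𝔞.subset_union_prime_finite (associatedPrimes.finite A M) (f := id) 0 0
    (fun _ h _ _ => h.1)).1 hs

/-- An ideal of zero divisors on `M ⧸ P` lies in a prime of the form `(P : m)`. -/
lemma exists_forall_mem_iff_smul_mem {𝔞 : Ideal A} {P : Submodule A M}
    (h : ∀ y ∈ 𝔞, ¬ IsSMulRegular (M ⧸ P) y) :
    ∃ q : Ideal A, q.IsPrime ∧ 𝔞 ≤ q ∧ ∃ m : M, ∀ y, y ∈ q ↔ y • m ∈ P := by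
  obtain ⟨q, hq, hle⟩ := exists_isAssociatedPrime_of_forall_not_isSMulRegular h
  obtain ⟨hp, m, hm⟩ := isAssociatedPrime_iff.1 hq
  obtain ⟨m, rfl⟩ := P.mkQ_surjective m
  refine ⟨q, hp, hle, m, fun y => ?_⟩
  rw [hm, Submodule.mem_colon_singleton, Submodule.mem_bot, ← map_smul,
    Submodule.mkQ_apply, Submodule.Quotient.mk_eq_zero]

lemma exists_isWeaklyRegular_of_le_kgrSeq {𝔞 : Ideal A} {x : Fin n → A} (hx : ∀ j, x j ∈ 𝔞)
    {k : ℕ} (h : (k : ℕ∞) ≤ kgrSeq A M x) :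
    ∃ rs : List A, rs.length = k ∧ (∀ r ∈ rs, r ∈ 𝔞) ∧ IsWeaklyRegular M rs := by
  induction k generalizing M with
  | zero => exact ⟨[], by simp⟩
  | succ k ih =>
    obtain ⟨y, hy, hreg⟩ : ∃ y ∈ 𝔞, IsSMulRegular M y := by
      by_contra! hz
      obtain ⟨q, hq, hle⟩ := exists_isAssociatedPrime_of_forall_not_isSMulRegular hz
      obtain ⟨hp, m, rfl⟩ := isAssociatedPrime_iff.1 hq
      rw [Koszul.le_kgrSeq_iff] at h
      have : m = 0 := (h 0 (by omega)).eq_zero fun j => by simpa using hle (hx j)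
      exact hp.ne_top (by simp [this])
    obtain ⟨rs, hl, hrs, hw⟩ := ih (le_kgrSeq_quotSMulTop hreg h)
    exact ⟨y :: rs, by simp [hl], by simpa [hy] using hrs, .cons hreg hw⟩

lemma exists_isWeaklyRegular_of_le_kgr {𝔞 : Ideal A} {k : ℕ} (h : (k : ℕ∞) ≤ kgr A 𝔞 M) :
    ∃ rs : List A, rs.length = k ∧ (∀ r ∈ rs, r ∈ 𝔞) ∧ IsWeaklyRegular M rs := by
  obtain ⟨n, x, hx, h⟩ := exists_le_kgrSeq h
  exact exists_isWeaklyRegular_of_le_kgrSeq hx h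

end Grade

section Localization

variable {A : Type*} [CommRing A] {M : Type*} [AddCommGroup M] [Module A M]

/-- If `q` is exactly the annihilator of the class of `m` modulo a weakly regular sequence `rs`
in `q`, then the depth of the localization at `q` is at most the length of `rs`. -/
lemma kgr_localizedModule_lt {q : Ideal A} [q.IsPrime] {rs : List A}
    (h : IsWeaklyRegular M rs) {m : M}
    (hm : ∀ y, y ∈ q ↔ y • m ∈ (Ideal.ofList rs • ⊤ : Submodule A M)) :
    ¬ ((rs.length + 1 : ℕ) : ℕ∞) ≤ kgr (Localization.AtPrime q)
      (IsLocalRing.maximalIdeal (Localization.AtPrime q))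
      (LocalizedModule q.primeCompl M) := by
  let f := LocalizedModule.mkLinearMap q.primeCompl M
  have hs : (Ideal.ofList (rs.map (algebraMap A (Localization.AtPrime q))) • ⊤ :
      Submodule (Localization.AtPrime q) (LocalizedModule q.primeCompl M)) =
      (Ideal.ofList rs • ⊤ : Submodule A M).localized' (Localization.AtPrime q) q.primeCompl f := by
    rw [Submodule.localized'_smul, Ideal.localized'_eq_map, Submodule.localized'_top,
      Ideal.map_ofList]
  have hmem : ∀ z ∈ (Ideal.ofList rs • ⊤ : Submodule A M), f z ∈
      (Ideal.ofList rs • ⊤ : Submodule A M).localized' (Localization.AtPrime q) q.primeCompl f :=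
    fun z hz => ⟨z, hz, 1, by simp⟩
  have := kgr_lt_of_smul_mem (𝔞 := IsLocalRing.maximalIdeal (Localization.AtPrime q))
    (h.of_isLocalizedModule (Localization.AtPrime q) q.primeCompl f) (m := f m) ?_ ?_
  · simpa using this
  · rw [hs]
    rintro ⟨z, hz, s, hzs⟩
    rw [IsLocalizedModule.mk'_eq_iff, Submonoid.smul_def, ← map_smul,
      IsLocalizedModule.eq_iff_exists q.primeCompl] at hzs
    obtain ⟨c, hc⟩ := hzs
    have : ((c * s : q.primeCompl) : A) • m ∈ (Ideal.ofList rs • ⊤ : Submodule A M) := by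
      have e : ((c * s : q.primeCompl) : A) • m = c • (s : A) • m := by
        rw [Submonoid.smul_def, smul_smul]; rfl
      rw [e, ← hc]
      exact Submodule.smul_mem _ _ hz
    exact (c * s).2 ((hm _).2 this)
  · rw [hs, ← Localization.AtPrime.map_eq_maximalIdeal]
    intro y hy
    induction hy using Submodule.span_induction with
    | mem y h =>
      obtain ⟨a, ha, rfl⟩ := h
      rw [algebraMap_smul, ← map_smul]
      exact hmem _ ((hm a).1 ha)
    | zero => simp
    | add a b _ _ ha hb => rw [add_smul]; exact add_mem ha hb
    | smul a b _ hb => rw [smul_assoc]; exact Submodule.smul_mem _ _ hb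

lemma idealHeight_le_height {𝔞 : Ideal A} {p : PrimeSpectrum A} (h : 𝔞 ≤ p.asIdeal) :
    idealHeight A 𝔞 ≤ p.asIdeal.height := by
  rw [p.height_eq_orderHeight]
  exact iInf₂_le p h

lemma idealHeight_asIdeal (p : PrimeSpectrum A) :
    idealHeight A p.asIdeal = p.asIdeal.height := by
  refine le_antisymm (idealHeight_le_height le_rfl) ?_
  rw [p.height_eq_orderHeight]
  exact le_iInf₂ fun q hq => Order.height_mono hq

end Localization

/-- The depth of a nonzero finite module is at most the dimension of the local ring. -/
lemma kgr_maximalIdeal_le_ringKrullDim {R : Type*} [CommRing R] [IsLocalRing R]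
    [IsNoetherianRing R] (N : Type*) [AddCommGroup N] [Module R N] [Module.Finite R N]
    [Nontrivial N] {k : ℕ} (h : (k : ℕ∞) ≤ kgr R (IsLocalRing.maximalIdeal R) N) :
    (k : WithBot ℕ∞) ≤ ringKrullDim R := by
  obtain ⟨rs, rfl, hrs, hw⟩ := exists_isWeaklyRegular_of_le_kgr h
  have hr := IsLocalRing.isRegular_iff_isWeaklyRegular_of_subset_maximalIdeal hrs |>.2 hw
  refine le_trans ?_ (Module.supportDim_le_ringKrullDim R N)
  rw [← Module.supportDim_add_length_eq_supportDim_of_isRegular rs hr]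
  have : Nontrivial (N ⧸ (Ideal.ofList rs • ⊤ : Submodule R N)) := hr.quot_ofList_smul_nontrivial ⊤
  have : Nonempty (Module.support R (N ⧸ (Ideal.ofList rs • ⊤ : Submodule R N))) :=
    Module.nonempty_support_of_nontrivial.to_subtype
  have h0 : 0 ≤ Module.supportDim R (N ⧸ (Ideal.ofList rs • ⊤ : Submodule R N)) :=
    Order.krullDim_nonneg
  exact le_add_of_nonneg_left h0

/-- Let `A` be Noetherian and `M` a finitely generated `A`-module. Then
`height 𝔞 ≤ grade_A(𝔞, M) (= kgr_A(𝔞, M))` for every ideal `𝔞` of `A` iff `M_𝔭` is a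
maximal Cohen-Macaulay `A_𝔭`-module (i.e. `depth_{A_𝔭} M_𝔭 = dim A_𝔭`) for every prime
`𝔭 ∈ Supp_A(M)`. (For finitely generated modules over a Noetherian ring, the classical
grade coincides with the Koszul grade, and depth is the Koszul grade of the maximal
ideal.) -/
theorem height_le_grade_iff_maximalCM {A : Type*} [CommRing A] [IsNoetherianRing A]
    (M : Type*) [AddCommGroup M] [Module A M] [Module.Finite A M] :
    (∀ 𝔞 : Ideal A, idealHeight A 𝔞 ≤ kgr A 𝔞 M) ↔
      ∀ 𝔭 : PrimeSpectrum A, 𝔭 ∈ Module.support A M →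
        (kgr (Localization.AtPrime 𝔭.asIdeal)
            (IsLocalRing.maximalIdeal (Localization.AtPrime 𝔭.asIdeal))
            (LocalizedModule 𝔭.asIdeal.primeCompl M) : WithBot ℕ∞) =
          ringKrullDim (Localization.AtPrime 𝔭.asIdeal) := by
  constructor
  · intro h p hp
    have : Nontrivial (LocalizedModule p.asIdeal.primeCompl M) := Module.mem_support_iff.1 hp
    have hdim := IsLocalization.AtPrime.ringKrullDim_eq_height p.asIdeal
      (Localization.AtPrime p.asIdeal)
    rw [hdim]
    norm_cast
    refine le_antisymm (ENat.forall_natCast_le_iff_le.1 fun k hk => ?_)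
      (ENat.forall_natCast_le_iff_le.1 fun k hk => ?_)
    · have := kgr_maximalIdeal_le_ringKrullDim _ hk
      rw [hdim] at this
      exact_mod_cast this
    · rw [← idealHeight_asIdeal] at hk
      obtain ⟨rs, rfl, hrs, hw⟩ := exists_isWeaklyRegular_of_le_kgr (hk.trans (h p.asIdeal))
      have := length_le_kgr (𝔞 := IsLocalRing.maximalIdeal (Localization.AtPrime p.asIdeal))
        (fun r hr => ?_) (hw.of_isLocalizedModule (Localization.AtPrime p.asIdeal)
          p.asIdeal.primeCompl (LocalizedModule.mkLinearMap p.asIdeal.primeCompl M))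
      · simpa using this
      · obtain ⟨a, ha, rfl⟩ := List.mem_map.1 hr
        exact (IsLocalization.AtPrime.to_map_mem_maximal_iff _ p.asIdeal a).2 (hrs a ha)
  · intro h 𝔞
    refine ENat.forall_natCast_le_iff_le.1 fun n hn => ?_
    suffices H : ∀ k ≤ n, ∃ rs : List A, rs.length = k ∧ (∀ r ∈ rs, r ∈ 𝔞) ∧
        IsWeaklyRegular M rs by
      obtain ⟨rs, rfl, hrs, hw⟩ := H n le_rfl
      exact length_le_kgr hrs hw
    intro k
    induction k with
    | zero => exact fun _ => ⟨[], by simp⟩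
    | succ k ih =>
      intro hk
      obtain ⟨rs, rfl, hrs, hw⟩ := ih (by omega)
      obtain ⟨y, hy, hreg⟩ : ∃ y ∈ 𝔞,
          IsSMulRegular (M ⧸ (Ideal.ofList rs • ⊤ : Submodule A M)) y := by
        by_contra! hz
        obtain ⟨q, hp, hle, m, hqm⟩ := exists_forall_mem_iff_smul_mem hz
        have hsupp : (⟨q, hp⟩ : PrimeSpectrum A) ∈ Module.support A M := by
          rw [Module.mem_support_iff_exists_annihilator]
          refine ⟨m, fun y hy => (hqm y).2 ?_⟩
          rw [(Submodule.mem_annihilator_span_singleton _ _).1 hy]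
          exact zero_mem _
        have hCM := h ⟨q, hp⟩ hsupp
        rw [IsLocalization.AtPrime.ringKrullDim_eq_height q (Localization.AtPrime q)] at hCM
        have hCM := WithBot.coe_injective hCM
        have hlen : ((rs.length + 1 : ℕ) : ℕ∞) ≤ q.height :=
          le_trans (by exact_mod_cast hk) (hn.trans (idealHeight_le_height (p := ⟨q, hp⟩) hle))
        exact kgr_localizedModule_lt hw hqm (hlen.trans_eq hCM.symm)
      refine ⟨rs ++ [y], by simp, ?_, ?_⟩
      · intro r hr
        rcases List.mem_append.1 hr with hr | hr
        · exact hrs r hr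
        · rwa [List.mem_singleton.1 hr]
      · rw [isWeaklyRegular_append_iff, isWeaklyRegular_singleton_iff]
        exact ⟨hw, hreg⟩
end
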